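/- arXiv:0805.0092 — 4 statements merged into one kernel-verified Lean document; each statement's English description precedes it below -/
import Mathlib

section
/- Let α, β, η, γ be real numbers with (α,β) ≠ (0,0) and let ρ₁ > 0, ρ₂ ≥ 0. Then there exists a unique r* ≥ 0 satisfying the fixed-point equation R_w(α,β,ρ₁(1−2^{−r*})) = R_w(η,γ,ρ₂) − r*. -/
/-- The Wyner per-cell sum-rate `R_w(a,b,ρ) = ∫₀¹ log₂(1 + ρ·(b + 2a·cos(2πf))²) df`. -/
noncomputable def Rw (a b ρ : ℝ) : ℝ :=
  ∫ f in (0:ℝ)..1, Real.logb 2 (1 + ρ * (b + 2 * a * Real.cos (2 * Real.pi * f)) ^ 2)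

theorem continuous_Rw_integrand (a b : ℝ) :
    Continuous fun p : ℝ × ℝ ↦
      Real.logb 2 (1 + max p.1 0 * (b + 2 * a * Real.cos (2 * Real.pi * p.2)) ^ 2) := by
  refine Continuous.div_const (Continuous.log (by fun_prop) fun p ↦ ?_) _
  have := mul_nonneg (le_max_right p.1 0) (sq_nonneg (b + 2 * a * Real.cos (2 * Real.pi * p.2)))
  positivity

theorem continuousOn_Rw (a b : ℝ) : ContinuousOn (Rw a b) (Set.Ici 0) := by
  have h := intervalIntegral.continuous_parametric_intervalIntegral_of_continuous'
    (μ := MeasureTheory.volume)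
    (f := fun x f ↦ Real.logb 2 (1 + max x 0 * (b + 2 * a * Real.cos (2 * Real.pi * f)) ^ 2))
    (continuous_Rw_integrand a b) 0 1
  refine h.continuousOn.congr fun x hx ↦ ?_
  simp only [Rw, max_eq_left (Set.mem_Ici.1 hx)]

theorem intervalIntegrable_Rw_integrand (a b : ℝ) {x : ℝ} (hx : 0 ≤ x) :
    IntervalIntegrable
      (fun f ↦ Real.logb 2 (1 + x * (b + 2 * a * Real.cos (2 * Real.pi * f)) ^ 2))
      MeasureTheory.volume 0 1 := by
  have h := (continuous_Rw_integrand a b).comp (Continuous.prodMk_right x)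
  simp only [Function.comp_def, max_eq_left hx] at h
  exact h.intervalIntegrable 0 1

theorem monotoneOn_Rw (a b : ℝ) : MonotoneOn (Rw a b) (Set.Ici 0) := by
  intro x hx y hy hxy
  rw [Set.mem_Ici] at hx hy
  refine intervalIntegral.integral_mono_on zero_le_one (intervalIntegrable_Rw_integrand a b hx)
    (intervalIntegrable_Rw_integrand a b hy) fun f _ ↦ ?_
  exact Real.logb_le_logb_of_le one_lt_two (by positivity) (by gcongr)

theorem Rw_zero (a b : ℝ) : Rw a b 0 = 0 := by
  simp [Rw]

theorem Rw_nonneg (a b : ℝ) {x : ℝ} (hx : 0 ≤ x) : 0 ≤ Rw a b x :=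
  Rw_zero a b ▸ monotoneOn_Rw a b Set.self_mem_Ici hx hx

/-- For `(α,β) ≠ (0,0)`, `ρ₁ > 0` and `ρ₂ ≥ 0`, there is a unique `r* ≥ 0` solving the
CF fixed-point equation `R_w(α,β,ρ₁(1−2^{−r*})) = R_w(η,γ,ρ₂) − r*`. -/
theorem stmt_4 (α β η γ ρ₁ ρ₂ : ℝ) (hαβ : (α, β) ≠ (0, 0)) (hρ₁ : 0 < ρ₁) (hρ₂ : 0 ≤ ρ₂) :
    ∃! r : ℝ, 0 ≤ r ∧ Rw α β (ρ₁ * (1 - (2:ℝ) ^ (-r))) = Rw η γ ρ₂ - r := by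
  set C := Rw η γ ρ₂
  have hC : 0 ≤ C := Rw_nonneg η γ hρ₂
  have hmem : Set.MapsTo (fun r : ℝ ↦ ρ₁ * (1 - (2:ℝ) ^ (-r))) (Set.Ici 0) (Set.Ici 0) := by
    intro r hr
    rw [Set.mem_Ici] at hr
    exact mul_nonneg hρ₁.le
      (sub_nonneg.2 (Real.rpow_le_one_of_one_le_of_nonpos one_le_two (neg_nonpos.2 hr)))
  have hcont : ContinuousOn (fun r : ℝ ↦ Rw α β (ρ₁ * (1 - (2:ℝ) ^ (-r))) + r) (Set.Ici 0) := by
    refine ((continuousOn_Rw α β).comp (Continuous.continuousOn ?_) hmem).add continuousOn_id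
    exact continuous_const.mul (continuous_const.sub
      (continuous_const.rpow continuous_neg fun _ ↦ Or.inl two_ne_zero))
  have hmono : StrictMonoOn (fun r : ℝ ↦ Rw α β (ρ₁ * (1 - (2:ℝ) ^ (-r))) + r) (Set.Ici 0) := by
    intro r hr s hs hrs
    refine add_lt_add_of_le_of_lt (monotoneOn_Rw α β (hmem hr) (hmem hs) ?_) hrs
    have : (2:ℝ) ^ (-s) ≤ (2:ℝ) ^ (-r) :=
      Real.rpow_le_rpow_of_exponent_le one_le_two (neg_le_neg hrs.le)
    dsimp only
    gcongr
  obtain ⟨r, hr, hrC⟩ := intermediate_value_Icc hC (hcont.mono Set.Icc_subset_Ici_self)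
    (show C ∈ Set.Icc _ _ from
      ⟨by simpa [Rw_zero] using hC, le_add_of_nonneg_left (Rw_nonneg α β (hmem hC))⟩)
  refine ⟨r, ⟨hr.1, eq_sub_of_add_eq hrC⟩, fun s hs ↦ ?_⟩
  exact hmono.injOn hs.1 hr.1 ((eq_sub_iff_add_eq.1 hs.2).trans hrC.symm)
end

section
/- Let α, β, η, γ be real numbers with (α,β) ≠ (0,0) and let ρ₂ ≥ 0 be fixed. For ρ₁ > 0 let r*(ρ₁) be the unique nonnegative solution of the CF fixed-point equation and R_cf(ρ₁) the corresponding CF rate. Then as ρ₁ → ∞, r*(ρ₁) → 0 and R_cf(ρ₁) → R_w(η,γ,ρ₂). -/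
open Filter Real

/-- Bernoulli's inequality in logarithmic form: the chord of `log₂(1 + ρ·)` over `[0, M]`
lies below the graph. -/
lemma chord_le_logb_one_add_mul {ρ h M : ℝ} (hρ : 0 ≤ ρ) (hM : 0 < M) (h0 : 0 ≤ h)
    (hh : h ≤ M) : h * (logb 2 (1 + ρ * M) / M) ≤ logb 2 (1 + ρ * h) := by
  have hpos : 0 < 1 + ρ * M := by positivity
  have key : (1 + ρ * M) ^ (h / M) ≤ 1 + h / M * (ρ * M) :=
    rpow_one_add_le_one_add_mul_self (by nlinarith [mul_nonneg hρ hM.le])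
      (by positivity) ((div_le_one hM).2 hh)
  have e : 1 + h / M * (ρ * M) = 1 + ρ * h := by field_simp
  rw [e] at key
  have := logb_le_logb_of_le one_lt_two (by positivity) key
  rw [logb_rpow_eq_mul_logb_of_pos hpos] at this
  calc h * (logb 2 (1 + ρ * M) / M) = h / M * logb 2 (1 + ρ * M) := by ring
    _ ≤ _ := this

lemma integral_sq_transfer_pos {a b : ℝ} (hab : (a, b) ≠ (0, 0)) :
    0 < ∫ f in (0:ℝ)..1, (b + 2 * a * cos (2 * π * f)) ^ 2 := by
  refine intervalIntegral.integral_pos one_pos (by fun_prop) (fun _ _ => sq_nonneg _) ?_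
  by_cases h : b + 2 * a = 0
  · refine ⟨1 / 2, by norm_num, ?_⟩
    have e : 2 * π * (1 / 2) = π := by ring
    rw [e, cos_pi]
    refine sq_pos_iff.2 fun h' => hab ?_
    exact Prod.ext (by simp; linarith) (by simp; linarith)
  · exact ⟨0, by norm_num, by simpa using sq_pos_iff.2 h⟩

lemma tendsto_Rw_atTop {a b : ℝ} (hab : (a, b) ≠ (0, 0)) :
    Tendsto (Rw a b) atTop atTop := by
  set M : ℝ := (|b| + 2 * |a|) ^ 2 + 1 with hM
  have hMpos : 0 < M := by positivity
  have hle (f : ℝ) : (b + 2 * a * cos (2 * π * f)) ^ 2 ≤ M := by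
    have h1 : |b + 2 * a * cos (2 * π * f)| ≤ |b| + 2 * |a| := by
      refine (abs_add_le _ _).trans ?_
      simp only [abs_mul, abs_two]
      have := mul_le_mul_of_nonneg_left (abs_cos_le_one (2 * π * f))
        (by positivity : 0 ≤ 2 * |a|)
      linarith
    have h2 := pow_le_pow_left₀ (abs_nonneg _) h1 2
    rw [sq_abs] at h2
    linarith
  have hlog : Tendsto (fun ρ : ℝ => logb 2 (1 + ρ * M)) atTop atTop :=
    (tendsto_logb_atTop one_lt_two).comp
      (tendsto_atTop_add_const_left _ _ (tendsto_id.atTop_mul_const hMpos))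
  refine tendsto_atTop_mono' _ ?_
    ((hlog.atTop_div_const hMpos).const_mul_atTop (integral_sq_transfer_pos hab))
  filter_upwards [eventually_ge_atTop 0] with ρ hρ
  rw [Rw, ← intervalIntegral.integral_mul_const]
  refine intervalIntegral.integral_mono_on zero_le_one ?_ ?_ fun f _ =>
    chord_le_logb_one_add_mul hρ hMpos (sq_nonneg _) (hle f)
  · exact Continuous.intervalIntegrable (by fun_prop) _ _
  · refine Continuous.intervalIntegrable ?_ _ _
    unfold logb
    refine (Continuous.log (by fun_prop) fun f => ?_).div_const _
    positivity

/-- Fix `ρ₂ ≥ 0` and `(α,β) ≠ (0,0)`. If for each `ρ₁ > 0`, `r*(ρ₁)` is the nonnegative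
solution of the CF fixed-point equation, then as `ρ₁ → ∞` one has `r*(ρ₁) → 0` and
`R_cf(ρ₁) → R_w(η,γ,ρ₂)`. -/
theorem stmt_6 (α β η γ ρ₂ : ℝ) (hαβ : (α, β) ≠ (0, 0)) (hρ₂ : 0 ≤ ρ₂)
    (rstar : ℝ → ℝ)
    (hrs : ∀ ρ₁ : ℝ, 0 < ρ₁ → 0 ≤ rstar ρ₁ ∧
      Rw α β (ρ₁ * (1 - (2:ℝ) ^ (-(rstar ρ₁)))) = Rw η γ ρ₂ - rstar ρ₁) :
    Filter.Tendsto rstar Filter.atTop (nhds 0) ∧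
    Filter.Tendsto (fun ρ₁ => Rw α β (ρ₁ * (1 - (2:ℝ) ^ (-(rstar ρ₁)))))
      Filter.atTop (nhds (Rw η γ ρ₂)) := by
  have hr : Tendsto rstar atTop (nhds 0) := by
    refine tendsto_order.2 ⟨fun c hc => ?_, fun ε hε => ?_⟩
    · filter_upwards [eventually_gt_atTop 0] with ρ hρ using hc.trans_le (hrs ρ hρ).1
    · obtain ⟨A, hA⟩ := eventually_atTop.1
        ((tendsto_Rw_atTop hαβ).eventually_gt_atTop (Rw η γ ρ₂))
      have hδ : 0 < 1 - (2:ℝ) ^ (-ε) :=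
        sub_pos.2 (rpow_lt_one_of_one_lt_of_neg one_lt_two (by linarith))
      filter_upwards [eventually_gt_atTop 0,
        eventually_ge_atTop (A / (1 - (2:ℝ) ^ (-ε)))] with ρ hρ hρA
      by_contra! hlt
      have hpow : (2:ℝ) ^ (-(rstar ρ)) ≤ (2:ℝ) ^ (-ε) :=
        rpow_le_rpow_of_exponent_le one_le_two (by linarith)
      have hAle : A ≤ ρ * (1 - (2:ℝ) ^ (-(rstar ρ))) :=
        ((div_le_iff₀ hδ).1 hρA).trans
          (mul_le_mul_of_nonneg_left (by linarith) hρ.le)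
      linarith [hA _ hAle, (hrs ρ hρ).1, (hrs ρ hρ).2]
  refine ⟨hr, ?_⟩
  have hlim : Tendsto (fun ρ => Rw η γ ρ₂ - rstar ρ) atTop (nhds (Rw η γ ρ₂)) := by
    simpa using hr.const_sub (Rw η γ ρ₂)
  refine hlim.congr' ?_
  filter_upwards [eventually_gt_atTop 0] with ρ hρ using (hrs ρ hρ).2.symm
end

section
/- Let α, β, η, γ be real numbers with (α,β) ≠ (0,0) and let ρ₁ > 0 be fixed. For ρ₂ ≥ 0 let r*(ρ₂) be the unique nonnegative solution of the CF fixed-point equation and R_cf(ρ₂) the corresponding CF rate. Then both r*(ρ₂) and R_cf(ρ₂) are nondecreasing functions of ρ₂; in particular the CF rate increases with the relay transmit power. -/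
open Set in
/-- The Wyner rate is nondecreasing in the SNR. -/
theorem Rw_monotoneOn (a b : ℝ) : MonotoneOn (Rw a b) (Ici 0) := by
  have pos {ρ : ℝ} (hρ : 0 ≤ ρ) (f : ℝ) :
      0 < 1 + ρ * (b + 2 * a * Real.cos (2 * Real.pi * f)) ^ 2 := by positivity
  have integrable {ρ : ℝ} (hρ : 0 ≤ ρ) : IntervalIntegrable
      (fun f => Real.logb 2 (1 + ρ * (b + 2 * a * Real.cos (2 * Real.pi * f)) ^ 2))
      MeasureTheory.volume 0 1 := by
    refine Continuous.intervalIntegrable ?_ 0 1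
    exact (Continuous.log (by fun_prop) fun f => (pos hρ f).ne').div_const _
  intro x hx y hy hxy
  refine intervalIntegral.integral_mono_on zero_le_one (integrable hx) (integrable hy) ?_
  intro f _
  refine Real.logb_le_logb_of_le one_lt_two (pos hx f) ?_
  gcongr

open Set in
/-- The rate after compression at `r` bits is nondecreasing in `r`. -/
theorem Rw_compressed_monotoneOn (a b : ℝ) {ρ : ℝ} (hρ : 0 ≤ ρ) :
    MonotoneOn (fun r : ℝ => Rw a b (ρ * (1 - (2 : ℝ) ^ (-r)))) (Ici 0) := by
  refine (Rw_monotoneOn a b).comp ?_ fun r hr => ?_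
  · intro r _ s _ hrs
    have : (2 : ℝ) ^ (-s) ≤ 2 ^ (-r) :=
      Real.rpow_le_rpow_of_exponent_le one_le_two (neg_le_neg hrs)
    dsimp only
    gcongr
  · have : (2 : ℝ) ^ (-r) ≤ 1 :=
      Real.rpow_le_one_of_one_le_of_nonpos one_le_two (neg_nonpos.2 hr)
    exact mul_nonneg hρ (sub_nonneg.2 this)

/-- Fix `ρ₁ > 0` and `(α,β) ≠ (0,0)`. If for each `ρ₂ ≥ 0`, `r*(ρ₂)` is the nonnegative
solution of the CF fixed-point equation, then both `r*(ρ₂)` and the CF rate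
`R_cf(ρ₂) = R_w(α,β,ρ₁(1−2^{−r*(ρ₂)}))` are nondecreasing in `ρ₂` on `[0,∞)`. -/
theorem stmt_8 (α β η γ ρ₁ : ℝ) (hαβ : (α, β) ≠ (0, 0)) (hρ₁ : 0 < ρ₁)
    (rstar : ℝ → ℝ)
    (hrs : ∀ ρ₂ : ℝ, 0 ≤ ρ₂ → 0 ≤ rstar ρ₂ ∧
      Rw α β (ρ₁ * (1 - (2:ℝ) ^ (-(rstar ρ₂)))) = Rw η γ ρ₂ - rstar ρ₂) :
    MonotoneOn rstar (Set.Ici 0) ∧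
    MonotoneOn (fun ρ₂ => Rw α β (ρ₁ * (1 - (2:ℝ) ^ (-(rstar ρ₂))))) (Set.Ici 0) := by
  have rate_mono := Rw_compressed_monotoneOn α β hρ₁.le
  have rstar_mono : MonotoneOn rstar (Set.Ici 0) := by
    intro x hx y hy hxy
    obtain ⟨_, hx_eq⟩ := hrs x hx
    obtain ⟨hy_nonneg, hy_eq⟩ := hrs y hy
    by_contra! hlt
    have h := rate_mono hy_nonneg (hy_nonneg.trans hlt.le) hlt.le
    dsimp only at h
    linarith [Rw_monotoneOn η γ hx hy hxy]
  exact ⟨rstar_mono, rate_mono.comp rstar_mono fun x hx => (hrs x hx).1⟩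
end

section
/- Let μ > 0, P ≥ 0, α, β ∈ ℝ, and σ₁ > 0 (so that Pβ² + σ₁² > 0). Define the relay output power σ_r²(g) = (Pβ²+σ₁²)g²/√(1−(2μg)⁴) + 4Pα²g²/(√(1−(2μg)²) + 1 − (2μg)²) for g ∈ [0, 1/(2μ)). Then σ_r² is continuous and strictly increasing on [0, 1/(2μ)), σ_r²(0) = 0, and σ_r²(g) → ∞ as g → (1/(2μ))⁻; consequently, for every Q > 0 there is a unique g_o ∈ (0, 1/(2μ)) with σ_r²(g_o) = Q. -/
/-- The AF relay steady-state output power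
`σ_r²(g) = (Pβ²+σ₁²)g²/√(1−(2μg)⁴) + 4Pα²g²/(√(1−(2μg)²) + 1 − (2μg)²)`. -/
noncomputable def relayPower (P α β σ₁ μ g : ℝ) : ℝ :=
  (P * β ^ 2 + σ₁ ^ 2) * g ^ 2 / Real.sqrt (1 - (2 * μ * g) ^ 4) +
    4 * P * α ^ 2 * g ^ 2 / (Real.sqrt (1 - (2 * μ * g) ^ 2) + 1 - (2 * μ * g) ^ 2)

/-- The loop gain `2μg` lies in `[0, 1)` when `g ∈ [0, 1/(2μ))`. -/
lemma loopGain_mem_Ico {μ g : ℝ} (hμ : 0 < μ) (hg : g ∈ Set.Ico 0 (1 / (2 * μ))) :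
    2 * μ * g ∈ Set.Ico (0 : ℝ) 1 := by
  have h := (lt_div_iff₀ (by positivity : 0 < 2 * μ)).1 hg.2
  exact ⟨mul_nonneg (by positivity) hg.1, by linarith⟩

lemma sqrt_one_sub_pow_pos {x : ℝ} (hx : x ∈ Set.Ico (0 : ℝ) 1) {n : ℕ} (hn : n ≠ 0) :
    0 < √(1 - x ^ n) :=
  Real.sqrt_pos.2 (sub_pos.2 (pow_lt_one₀ hx.1 hx.2 hn))

lemma sqrt_add_one_sub_sq_pos {x : ℝ} (hx : x ∈ Set.Ico (0 : ℝ) 1) :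
    0 < √(1 - x ^ 2) + 1 - x ^ 2 := by
  have h₁ := sqrt_one_sub_pow_pos hx two_ne_zero
  have h₂ := pow_lt_one₀ hx.1 hx.2 two_ne_zero
  linarith

lemma relayPower_zero (P α β σ₁ μ : ℝ) : relayPower P α β σ₁ μ 0 = 0 := by
  simp [relayPower]

lemma continuousOn_relayPower (P α β σ₁ : ℝ) {μ : ℝ} (hμ : 0 < μ) :
    ContinuousOn (relayPower P α β σ₁ μ) (Set.Ico 0 (1 / (2 * μ))) := by
  unfold relayPower
  refine ContinuousOn.add (ContinuousOn.div (by fun_prop) (by fun_prop) fun g hg => ?_)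
    (ContinuousOn.div (by fun_prop) (by fun_prop) fun g hg => ?_)
  · exact (sqrt_one_sub_pow_pos (loopGain_mem_Ico hμ hg) four_ne_zero).ne'
  · exact (sqrt_add_one_sub_sq_pos (loopGain_mem_Ico hμ hg)).ne'

lemma strictMonoOn_relayPower {P σ₁ μ : ℝ} (α β : ℝ) (hμ : 0 < μ) (hP : 0 ≤ P) (hσ₁ : 0 < σ₁) :
    StrictMonoOn (relayPower P α β σ₁ μ) (Set.Ico 0 (1 / (2 * μ))) := by
  intro a ha b hb hab
  have hxb := loopGain_mem_Ico hμ hb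
  have hx₀ := (loopGain_mem_Ico hμ ha).1
  have hx : 2 * μ * a ≤ 2 * μ * b := by gcongr
  have ha₀ : 0 ≤ a := ha.1
  refine add_lt_add_of_lt_of_le (div_lt_div₀ ?_ ?_ (by positivity) ?_)
    (div_le_div₀ (by positivity) ?_ ?_ ?_)
  · gcongr
  · gcongr
  · exact sqrt_one_sub_pow_pos hxb four_ne_zero
  · gcongr
  · exact sqrt_add_one_sub_sq_pos hxb
  · rw [add_sub_assoc, add_sub_assoc]
    gcongr

lemma tendsto_relayPower_atTop {P σ₁ μ : ℝ} (α β : ℝ) (hμ : 0 < μ) (hP : 0 ≤ P) (hσ₁ : 0 < σ₁) :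
    Filter.Tendsto (relayPower P α β σ₁ μ)
      (nhdsWithin (1 / (2 * μ)) (Set.Iio (1 / (2 * μ)))) Filter.atTop := by
  have hmem : ∀ᶠ g in nhdsWithin (1 / (2 * μ)) (Set.Iio (1 / (2 * μ))),
      g ∈ Set.Ico 0 (1 / (2 * μ)) := Ico_mem_nhdsLT (by positivity)
  have hnum : Filter.Tendsto (fun g : ℝ => (P * β ^ 2 + σ₁ ^ 2) * g ^ 2)
      (nhdsWithin (1 / (2 * μ)) (Set.Iio (1 / (2 * μ))))
      (nhds ((P * β ^ 2 + σ₁ ^ 2) * (1 / (2 * μ)) ^ 2)) :=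
    (Continuous.tendsto (by fun_prop) _).mono_left nhdsWithin_le_nhds
  have hden : Filter.Tendsto (fun g : ℝ => √(1 - (2 * μ * g) ^ 4))
      (nhdsWithin (1 / (2 * μ)) (Set.Iio (1 / (2 * μ)))) (nhdsWithin 0 (Set.Ioi 0)) := by
    refine tendsto_nhdsWithin_iff.2 ⟨?_, hmem.mono fun g hg =>
      sqrt_one_sub_pow_pos (loopGain_mem_Ico hμ hg) four_ne_zero⟩
    have h : Continuous fun g : ℝ => √(1 - (2 * μ * g) ^ 4) := by fun_prop
    have hlim := (h.tendsto (1 / (2 * μ))).mono_left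
      (nhdsWithin_le_nhds (s := Set.Iio (1 / (2 * μ))))
    rwa [mul_one_div_cancel (by positivity), one_pow, sub_self, Real.sqrt_zero] at hlim
  refine Filter.tendsto_atTop_mono' _ (hmem.mono fun g hg => ?_)
    (hnum.pos_mul_atTop (by positivity) hden.inv_tendsto_nhdsGT_zero)
  have hpos := sqrt_add_one_sub_sq_pos (loopGain_mem_Ico hμ hg)
  exact le_add_of_nonneg_right (by positivity)

/-- For `μ > 0`, `P ≥ 0` and `σ₁ > 0`, the relay output power `σ_r²` is continuous and
strictly increasing on `[0, 1/(2μ))`, vanishes at `0`, blows up as `g → (1/(2μ))⁻`, and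
for every `Q > 0` there is a unique `g_o ∈ (0, 1/(2μ))` with `σ_r²(g_o) = Q`. -/
theorem stmt_15 (P α β σ₁ μ : ℝ) (hμ : 0 < μ) (hP : 0 ≤ P) (hσ₁ : 0 < σ₁) :
    ContinuousOn (fun g => relayPower P α β σ₁ μ g) (Set.Ico 0 (1 / (2 * μ))) ∧
    StrictMonoOn (fun g => relayPower P α β σ₁ μ g) (Set.Ico 0 (1 / (2 * μ))) ∧
    relayPower P α β σ₁ μ 0 = 0 ∧
    Filter.Tendsto (fun g => relayPower P α β σ₁ μ g)
      (nhdsWithin (1 / (2 * μ)) (Set.Iio (1 / (2 * μ)))) Filter.atTop ∧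
    ∀ Q : ℝ, 0 < Q → ∃! g : ℝ, g ∈ Set.Ioo 0 (1 / (2 * μ)) ∧ relayPower P α β σ₁ μ g = Q := by
  have hcont := continuousOn_relayPower P α β σ₁ hμ
  have hmono := strictMonoOn_relayPower α β hμ hP hσ₁
  have htop := tendsto_relayPower_atTop α β hμ hP hσ₁
  refine ⟨hcont, hmono, relayPower_zero P α β σ₁ μ, htop, fun Q hQ => ?_⟩
  obtain ⟨b, hQb, hb⟩ := ((htop.eventually_gt_atTop Q).and
    (Ioo_mem_nhdsLT (by positivity : 0 < 1 / (2 * μ)))).exists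
  obtain ⟨g, hg, hgQ⟩ := intermediate_value_Ioo hb.1.le
    (hcont.mono (Set.Icc_subset_Ico_right hb.2)) ⟨by rwa [relayPower_zero], hQb⟩
  refine ⟨g, ⟨⟨hg.1, hg.2.trans hb.2⟩, hgQ⟩, fun y hy => ?_⟩
  exact hmono.injOn (Set.Ioo_subset_Ico_self hy.1) ⟨hg.1.le, hg.2.trans hb.2⟩ (hy.2.trans hgQ.symm)
end
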